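/- Fix n ≥ 1 and resource cost functions C^1,…,C^m : {0,…,n} → ℝ_{≥0} with C^j(0) = 0. For each j, let (F̃^j, ρ^j) be an optimal solution of the linear program: maximize ρ over F ∈ ℝ^n (extended by F(0) = F(n+1) = 0) and ρ ∈ ℝ subject to C^j(y) − ρ·C^j(x) + (x−z)·F(x) − (y−z)·F(x+1) ≥ 0 for all (x,y,z) ∈ I_R(n), and suppose ρ^j > 0 for all j. Then the class 𝒢 of generalized congestion games with at most n users generated from the basis pairs {C^j, F̃^j}, j = 1,…,m, satisfies PoA(𝒢) = max_{j∈{1,…,m}} 1/ρ^j; i.e., the price of anarchy of the class equals the worst price of anarchy among the classes 𝒢^j each generated from the single pair {C^j, F̃^j}. -/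

import Mathlib

open Finset

/-- A generalized congestion game with user set `Fin n`. -/
structure GCG (n : ℕ) where
  R : Type
  finR : Fintype R
  decR : DecidableEq R
  act : Fin n → Finset (Finset R)
  act_ne : ∀ i, (act i).Nonempty
  Cr : R → ℕ → ℝ
  Fr : R → ℕ → ℝ
  Cr_nonneg : ∀ r k, 0 ≤ Cr r k
  Cr_zero : ∀ r, Cr r 0 = 0
  Fr_zero : ∀ r, Fr r 0 = 0
  Fr_top : ∀ r, Fr r (n + 1) = 0

attribute [instance] GCG.finR GCG.decR

namespace GCG

variable {n : ℕ}

/-- The number of users selecting resource `r` in allocation `a`. -/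
def load (G : GCG n) (a : Fin n → Finset G.R) (r : G.R) : ℕ :=
  (Finset.univ.filter fun i => r ∈ a i).card

/-- System cost of an allocation. -/
def cost (G : GCG n) (a : Fin n → Finset G.R) : ℝ :=
  ∑ r, G.Cr r (G.load a r)

/-- User `i`'s cost in allocation `a`. -/
def ucost (G : GCG n) (i : Fin n) (a : Fin n → Finset G.R) : ℝ :=
  ∑ r ∈ a i, G.Fr r (G.load a r)

/-- `a` is an admissible allocation. -/
def Valid (G : GCG n) (a : Fin n → Finset G.R) : Prop :=
  ∀ i, a i ∈ G.act i

/-- `a` is a pure Nash equilibrium. -/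
def IsNE (G : GCG n) (a : Fin n → Finset G.R) : Prop :=
  G.Valid a ∧ ∀ i : Fin n, ∀ b ∈ G.act i,
    G.ucost i a ≤ G.ucost i (Function.update a i b)

/-- Price of anarchy of `G`: worst equilibrium cost over optimal cost. -/
noncomputable def poa (G : GCG n) : ℝ :=
  sSup {x | ∃ a, G.IsNE a ∧ x = G.cost a} /
    sInf {x | ∃ a, G.Valid a ∧ x = G.cost a}

/-- `G` is `(lam, mu)`-generalized smooth. -/
def GenSmooth (G : GCG n) (lam mu : ℝ) : Prop :=
  ∀ a a' : Fin n → Finset G.R, G.Valid a → G.Valid a' →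
    (∑ i, G.ucost i (Function.update a i (a' i))) - (∑ i, G.ucost i a) + G.cost a
      ≤ lam * G.cost a' + mu * G.cost a

end GCG

/-- `G` is generated from the basis function pairs `(Cb j, Fb j)`, `j = 1, …, m`. -/
def GeneratedFrom {n m : ℕ} (G : GCG n) (Cb Fb : Fin m → ℕ → ℝ) : Prop :=
  ∃ α : G.R → Fin m → ℝ, (∀ r j, 0 ≤ α r j) ∧
    (∀ r k, G.Cr r k = ∑ j, α r j * Cb j k) ∧
    (∀ r k, G.Fr r k = ∑ j, α r j * Fb j k)

/-- Standing assumptions on the basis pairs: `Cᶨ ≥ 0`, `Cᶨ(0) = Fᶨ(0) = Fᶨ(n+1) = 0`. -/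
def BasisOK (n : ℕ) {m : ℕ} (Cb Fb : Fin m → ℕ → ℝ) : Prop :=
  ∀ j, (∀ k, 0 ≤ Cb j k) ∧ Cb j 0 = 0 ∧ Fb j 0 = 0 ∧ Fb j (n + 1) = 0

/-- `(x, y, z) ∈ I(n)`. -/
def memI (n x y z : ℕ) : Prop :=
  x ≤ n ∧ y ≤ n ∧ z ≤ x ∧ z ≤ y ∧ z + 1 ≤ x + y ∧ x + y ≤ n + z

/-- `(x, y, z) ∈ I_R(n)`. -/
def memIR (n x y z : ℕ) : Prop :=
  memI n x y z ∧ (x + y = n + z ∨ (x - z) * (y - z) * z = 0)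

/-- Price of anarchy of the class of all generalized congestion games generated from the basis. -/
noncomputable def classPoA (n : ℕ) {m : ℕ} (Cb Fb : Fin m → ℕ → ℝ) : ℝ :=
  sSup {x | ∃ G : GCG n, GeneratedFrom G Cb Fb ∧ x = G.poa}

/-- Generalized price of anarchy of the class generated from the basis. -/
noncomputable def classGPoA (n : ℕ) {m : ℕ} (Cb Fb : Fin m → ℕ → ℝ) : ℝ :=
  sInf {x | ∃ lam mu : ℝ, 0 < lam ∧ mu < 1 ∧
    (∀ G : GCG n, GeneratedFrom G Cb Fb → G.GenSmooth lam mu) ∧ x = lam / (1 - mu)}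

/-- Feasibility of `(ν, ρ)` in the linear program of Theorem 3.4. -/
def LPfeas (n : ℕ) {m : ℕ} (Cb Fb : Fin m → ℕ → ℝ) (ν ρ : ℝ) : Prop :=
  0 ≤ ν ∧ ∀ j : Fin m, ∀ x y z : ℕ, memIR n x y z →
    0 ≤ Cb j y - ρ * Cb j x +
      ν * (((x : ℝ) - (z : ℝ)) * Fb j x - ((y : ℝ) - (z : ℝ)) * Fb j (x + 1))

/-- Feasibility of `(F, ρ)` in the incentive-design linear program of Theorem 3.8 for the
resource cost function `Cj` (with the conventions `F(0) = F(n+1) = 0`). -/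
def LPfeasF (n : ℕ) (Cj F : ℕ → ℝ) (ρ : ℝ) : Prop :=
  F 0 = 0 ∧ F (n + 1) = 0 ∧ ∀ x y z : ℕ, memIR n x y z →
    0 ≤ Cj y - ρ * Cj x + ((x : ℝ) - (z : ℝ)) * F x - ((y : ℝ) - (z : ℝ)) * F (x + 1)

namespace GCG

variable {n : ℕ}

/-- The number of users selecting resource `r` in both allocations. -/
def overlap (G : GCG n) (a a' : Fin n → Finset G.R) (r : G.R) : ℕ :=
  (Finset.univ.filter fun i => r ∈ a i ∧ r ∈ a' i).card

theorem overlap_le_left (G : GCG n) (a a' : Fin n → Finset G.R) (r : G.R) :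
    G.overlap a a' r ≤ G.load a r :=
  Finset.card_le_card fun i hi => by simp_all

theorem overlap_le_right (G : GCG n) (a a' : Fin n → Finset G.R) (r : G.R) :
    G.overlap a a' r ≤ G.load a' r :=
  Finset.card_le_card fun i hi => by simp_all

theorem load_le (G : GCG n) (a : Fin n → Finset G.R) (r : G.R) : G.load a r ≤ n := by
  simpa [load] using Finset.card_le_univ (Finset.univ.filter fun i => r ∈ a i)

theorem load_add_load_le (G : GCG n) (a a' : Fin n → Finset G.R) (r : G.R) :
    G.load a r + G.load a' r ≤ n + G.overlap a a' r := by
  have h := Finset.card_union_add_card_inter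
    (Finset.univ.filter fun i => r ∈ a i) (Finset.univ.filter fun i => r ∈ a' i)
  rw [← Finset.filter_and] at h
  have h' := Finset.card_le_univ
    ((Finset.univ.filter fun i => r ∈ a i) ∪ (Finset.univ.filter fun i => r ∈ a' i))
  rw [Fintype.card_fin] at h'
  unfold load overlap
  omega

theorem load_update (G : GCG n) (a : Fin n → Finset G.R) (i : Fin n) (b : Finset G.R)
    {r : G.R} (hr : r ∈ b) :
    G.load (Function.update a i b) r = if r ∈ a i then G.load a r else G.load a r + 1 := by
  have h : (Finset.univ.filter fun k => r ∈ Function.update a i b k)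
      = insert i (Finset.univ.filter fun k => r ∈ a k) := by
    ext k
    by_cases hk : k = i
    · subst hk; simp [hr]
    · simp [hk]
  unfold load
  rw [h]
  split_ifs with hi
  · rw [Finset.insert_eq_of_mem (by simpa using hi)]
  · rw [Finset.card_insert_of_notMem (by simpa using hi)]

theorem ucost_update (G : GCG n) (a : Fin n → Finset G.R) (i : Fin n) (b : Finset G.R) :
    G.ucost i (Function.update a i b) =
      ∑ r ∈ b, if r ∈ a i then G.Fr r (G.load a r) else G.Fr r (G.load a r + 1) := by
  unfold ucost
  rw [Function.update_self]
  refine Finset.sum_congr rfl fun r hr => ?_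
  rw [G.load_update a i b hr]
  split_ifs <;> rfl

theorem sum_ucost (G : GCG n) (a : Fin n → Finset G.R) :
    ∑ i, G.ucost i a = ∑ r, (G.load a r : ℝ) * G.Fr r (G.load a r) := by
  have h : ∀ i, G.ucost i a = ∑ r, if r ∈ a i then G.Fr r (G.load a r) else 0 := fun i => by
    rw [Finset.sum_ite_mem, Finset.univ_inter, ucost]
  simp_rw [h]
  rw [Finset.sum_comm]
  refine Finset.sum_congr rfl fun r _ => ?_
  rw [← Finset.sum_filter, Finset.sum_const, nsmul_eq_mul, load]

theorem sum_ucost_update (G : GCG n) (a a' : Fin n → Finset G.R) :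
    ∑ i, G.ucost i (Function.update a i (a' i)) =
      ∑ r, ((G.overlap a a' r : ℝ) * G.Fr r (G.load a r) +
        ((G.load a' r : ℝ) - G.overlap a a' r) * G.Fr r (G.load a r + 1)) := by
  have h : ∀ i, G.ucost i (Function.update a i (a' i)) = ∑ r,
      ((if r ∈ a i ∧ r ∈ a' i then G.Fr r (G.load a r) - G.Fr r (G.load a r + 1) else 0) +
        if r ∈ a' i then G.Fr r (G.load a r + 1) else 0) := fun i => by
    rw [ucost_update, ← Finset.univ_inter (a' i), ← Finset.sum_ite_mem]
    refine Finset.sum_congr rfl fun r _ => ?_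
    by_cases h1 : r ∈ a i <;> by_cases h2 : r ∈ a' i <;> simp [h1, h2]
  simp_rw [h]
  rw [Finset.sum_comm]
  refine Finset.sum_congr rfl fun r _ => ?_
  rw [Finset.sum_add_distrib, ← Finset.sum_filter, ← Finset.sum_filter, Finset.sum_const,
    Finset.sum_const, nsmul_eq_mul, nsmul_eq_mul]
  unfold overlap load
  ring

theorem cost_nonneg (G : GCG n) (a : Fin n → Finset G.R) : 0 ≤ G.cost a :=
  Finset.sum_nonneg fun r _ => G.Cr_nonneg r _

theorem exists_valid (G : GCG n) : ∃ a, G.Valid a :=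
  ⟨fun i => (G.act_ne i).choose, fun i => (G.act_ne i).choose_spec⟩

theorem bddBelow_cost (G : GCG n) : BddBelow {x | ∃ a, G.Valid a ∧ x = G.cost a} :=
  ⟨0, by rintro _ ⟨a, -, rfl⟩; exact G.cost_nonneg a⟩

theorem poa_nonneg (G : GCG n) : 0 ≤ G.poa :=
  div_nonneg (Real.sSup_nonneg (by rintro _ ⟨a, -, rfl⟩; exact G.cost_nonneg a))
    (Real.sInf_nonneg (by rintro _ ⟨a, -, rfl⟩; exact G.cost_nonneg a))

theorem poa_le (G : GCG n) {M : ℝ} (hM : 0 < M)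
    (h : ∀ a a', G.IsNE a → G.Valid a' → G.cost a ≤ M * G.cost a') : G.poa ≤ M := by
  obtain ⟨v, hv⟩ := G.exists_valid
  have h0 : 0 ≤ sInf {x | ∃ a, G.Valid a ∧ x = G.cost a} :=
    Real.sInf_nonneg (by rintro _ ⟨a, -, rfl⟩; exact G.cost_nonneg a)
  refine div_le_of_le_mul₀ h0 hM.le ?_
  rw [← div_le_iff₀' hM]
  refine le_csInf ⟨_, v, hv, rfl⟩ ?_
  rintro _ ⟨a', ha', rfl⟩
  rw [div_le_iff₀' hM]
  refine Real.sSup_le ?_ (mul_nonneg hM.le (G.cost_nonneg a'))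
  rintro _ ⟨a, ha, rfl⟩
  exact h a a' ha ha'

theorem le_poa (G : GCG n) {M : ℝ} (hM : 0 < M)
    (h : ∀ a a', G.IsNE a → G.Valid a' → G.cost a ≤ M * G.cost a')
    {a a' : Fin n → Finset G.R} (ha : G.IsNE a) (ha' : G.Valid a') (hpos : 0 < G.cost a) :
    G.cost a / G.cost a' ≤ G.poa := by
  have hinf : 0 < sInf {x | ∃ a, G.Valid a ∧ x = G.cost a} := by
    refine lt_of_lt_of_le (div_pos hpos hM) (le_csInf ⟨_, a', ha', rfl⟩ ?_)
    rintro _ ⟨v, hv, rfl⟩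
    rw [div_le_iff₀' hM]
    exact h a v ha hv
  have hsup : G.cost a ≤ sSup {x | ∃ a, G.IsNE a ∧ x = G.cost a} :=
    le_csSup ⟨M * G.cost a', by rintro _ ⟨v, hv, rfl⟩; exact h v a' hv ha'⟩ ⟨a, ha, rfl⟩
  exact div_le_div₀ (hpos.le.trans hsup) hsup hinf (csInf_le G.bddBelow_cost ⟨a', ha', rfl⟩)

end GCG

/-- The constraints indexed by `I_R(n)` imply those indexed by `I(n)`. -/
theorem LPfeasF.of_memI {n : ℕ} {C F : ℕ → ℝ} {ρ : ℝ} (h : LPfeasF n C F ρ) {x y z : ℕ}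
    (hI : memI n x y z) :
    0 ≤ C y - ρ * C x + ((x : ℝ) - z) * F x - ((y : ℝ) - z) * F (x + 1) := by
  obtain ⟨-, -, h⟩ := h
  obtain ⟨hx, hy, hzx, hzy, h1, h2⟩ := hI
  rcases le_total (F x) (F (x + 1)) with hF | hF
  · have hz : x + y - n ≤ z := by omega
    have key := h x y (x + y - n) ⟨⟨hx, hy, by omega, by omega, by omega, by omega⟩, by
      rcases le_total n (x + y) with h' | h'
      · left; omega
      · right; simp [Nat.sub_eq_zero_of_le h']⟩
    have hz' : ((x + y - n : ℕ) : ℝ) ≤ z := by exact_mod_cast hz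
    nlinarith [mul_nonneg (sub_nonneg.2 hz') (sub_nonneg.2 hF)]
  · have hz : z ≤ min x y := le_min hzx hzy
    have key := h x y (min x y) ⟨⟨hx, hy, by omega, by omega, by omega, by omega⟩, by
      right
      rcases le_total x y with h' | h'
      · simp [h']
      · simp [h']⟩
    have hz' : (z : ℝ) ≤ (min x y : ℕ) := by exact_mod_cast hz
    nlinarith [mul_nonneg (sub_nonneg.2 hz') (sub_nonneg.2 hF)]

/-- Feasibility of every basis pair bounds the cost of each equilibrium. -/
theorem GeneratedFrom.cost_le {n m : ℕ} {Cb Fb : Fin m → ℕ → ℝ} {ρj : Fin m → ℝ} {ρ : ℝ}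
    (hC : ∀ j k, 0 ≤ Cb j k) (hC0 : ∀ j, Cb j 0 = 0)
    (hfeas : ∀ j, LPfeasF n (Cb j) (Fb j) (ρj j)) (hle : ∀ j, ρ ≤ ρj j)
    {G : GCG n} (hG : GeneratedFrom G Cb Fb)
    {a a' : Fin n → Finset G.R} (ha : G.IsNE a) (ha' : G.Valid a') :
    ρ * G.cost a ≤ G.cost a' := by
  obtain ⟨α, hα, hCr, hFr⟩ := hG
  have hres : ∀ r, 0 ≤ G.Cr r (G.load a' r) - ρ * G.Cr r (G.load a r) +
      ((G.load a r : ℝ) * G.Fr r (G.load a r) -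
        ((G.overlap a a' r : ℝ) * G.Fr r (G.load a r) +
          ((G.load a' r : ℝ) - G.overlap a a' r) * G.Fr r (G.load a r + 1))) := by
    intro r
    have h1 := G.load_le a r
    have h2 := G.load_le a' r
    have h3 := G.overlap_le_left a a' r
    have h4 := G.overlap_le_right a a' r
    have h5 := G.load_add_load_le a a' r
    generalize G.load a r = x at *
    generalize G.load a' r = y at *
    generalize G.overlap a a' r = z at *
    have hj : ∀ j, 0 ≤ Cb j y - ρ * Cb j x +
        (((x : ℝ) - z) * Fb j x - ((y : ℝ) - z) * Fb j (x + 1)) := by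
      intro j
      by_cases hxy : x + y = 0
      · obtain ⟨rfl, rfl⟩ : x = 0 ∧ y = 0 := by omega
        obtain rfl : z = 0 := by omega
        simp [hC0]
      · have := (hfeas j).of_memI (x := x) (y := y) (z := z)
          ⟨h1, h2, h3, h4, by omega, h5⟩
        nlinarith [mul_le_mul_of_nonneg_right (hle j) (hC j x)]
    have hsum := Finset.sum_nonneg fun j (_ : j ∈ Finset.univ) => mul_nonneg (hα r j) (hj j)
    refine hsum.trans_eq ?_
    simp only [hCr, hFr, Finset.mul_sum, ← Finset.sum_add_distrib, ← Finset.sum_sub_distrib]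
    exact Finset.sum_congr rfl fun j _ => by ring
  have hsum := Finset.sum_nonneg fun r (_ : r ∈ Finset.univ) => hres r
  have hne : ∑ i, G.ucost i a ≤ ∑ i, G.ucost i (Function.update a i (a' i)) :=
    Finset.sum_le_sum fun i _ => ha.2 i _ (ha' i)
  rw [G.sum_ucost, G.sum_ucost_update] at hne
  rw [Finset.sum_add_distrib, Finset.sum_sub_distrib, Finset.sum_sub_distrib,
    ← Finset.mul_sum] at hsum
  unfold GCG.cost
  linarith

/-- One-variable theorem of the alternative: if no `ν ≥ 0` satisfies `0 ≤ p t + ν * g t` for all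
`t`, then two of these constraints already have a nonnegative combination refuting it. -/
theorem exists_two_constraint_certificate {ι : Type*} [Fintype ι] (p g : ι → ℝ)
    (h : ∀ ν, 0 ≤ ν → ∃ t, p t + ν * g t < 0) :
    ∃ (t : Bool → ι) (θ : Bool → ℝ), (∀ s, 0 ≤ θ s) ∧ ∑ s, θ s * g (t s) ≤ 0 ∧
      ∑ s, θ s * p (t s) < 0 := by
  classical
  by_cases hsingle : ∃ t, p t < 0 ∧ g t ≤ 0
  · obtain ⟨t, hp, hg⟩ := hsingle
    refine ⟨fun _ => t, fun s => if s then 1 else 0, fun s => by cases s <;> simp, ?_, ?_⟩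
    · simpa using hg
    · simpa using hp
  push Not at hsingle
  obtain ⟨t₀, ht₀⟩ := h 0 le_rfl
  have ht₀ : p t₀ < 0 := by simpa using ht₀
  obtain ⟨t, ht, hmax⟩ := Finset.exists_max_image (Finset.univ.filter fun t => p t < 0)
    (fun t => -p t / g t) ⟨t₀, by simpa using ht₀⟩
  have hpt : p t < 0 := by simpa using ht
  have hgt := hsingle t hpt
  obtain ⟨s, hs⟩ := h (-p t / g t) (div_nonneg (by linarith) hgt.le)
  have hps : 0 ≤ p s := by
    by_contra! hps
    have hgs := hsingle s hps
    have hle := hmax s (by simpa using hps)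
    rw [div_le_iff₀ hgs] at hle
    linarith
  have hlt : p s * g t - p t * g s < 0 := by
    have := mul_lt_mul_of_pos_right hs hgt
    rw [zero_mul, add_mul] at this
    have e : -p t / g t * g s * g t = -p t * g s := by field_simp
    linarith
  have hgs : g s < 0 := by
    by_contra! hgs
    nlinarith [mul_nonneg hps hgt.le, mul_nonneg (neg_nonneg.2 hpt.le) hgs]
  refine ⟨fun b => if b then t else s, fun b => if b then -g s else g t, ?_, ?_, ?_⟩
  · rintro (_ | _)
    · exact hgt.le
    · exact (neg_pos.2 hgs).le
  · simp only [Fintype.sum_bool, if_true, Bool.false_eq_true, if_false]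
    linarith
  · simp only [Fintype.sum_bool, if_true, Bool.false_eq_true, if_false]
    linarith

theorem card_fin_val_mem_Ico {n l u : ℕ} (hu : u ≤ n) :
    (Finset.univ.filter fun k : Fin n => l ≤ k.val ∧ k.val < u).card = u - l := by
  rw [← Nat.card_Ico, ← Finset.card_map Fin.valEmbedding]
  congr 1
  ext k
  simp only [Finset.mem_map, Finset.mem_filter, Finset.mem_univ, true_and, Finset.mem_Ico,
    Fin.valEmbedding_apply]
  exact ⟨by rintro ⟨k, hk, rfl⟩; exact hk, fun hk => ⟨⟨k, by omega⟩, hk, rfl⟩⟩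

section CyclicGame

variable {n : ℕ} {ι : Type} [Fintype ι]

/-- The resources `(s, k)` whose cyclic distance from position `i` lies in `[l s, u s)`. -/
def cyclicArc (l u : ι → ℕ) (i : Fin n) : Finset (ι × Fin n) :=
  Finset.univ.filter fun r => l r.1 ≤ (r.2 - i).val ∧ (r.2 - i).val < u r.1

@[simp]
theorem mem_cyclicArc {l u : ι → ℕ} {i : Fin n} {r : ι × Fin n} :
    r ∈ cyclicArc l u i ↔ l r.1 ≤ (r.2 - i).val ∧ (r.2 - i).val < u r.1 := by
  simp [cyclicArc]

variable [NeZero n]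

theorem sum_cyclicArc {l u : ι → ℕ} (hu : ∀ s, u s ≤ n) (i : Fin n) (f : ι → ℝ) :
    ∑ r ∈ cyclicArc l u i, f r.1 = ∑ s, ((u s - l s : ℕ) : ℝ) * f s := by
  rw [cyclicArc, Finset.sum_filter, Fintype.sum_prod_type]
  refine Finset.sum_congr rfl fun s _ => ?_
  rw [← Finset.sum_filter]
  dsimp only
  rw [Finset.sum_const, nsmul_eq_mul, ← card_fin_val_mem_Ico (hu s)]
  congr 2
  exact Finset.card_equiv (Equiv.subRight i) fun k => by simp

variable [DecidableEq ι]

theorem card_users_cyclicArc {l u : ι → ℕ} {r : ι × Fin n} (hu : u r.1 ≤ n) :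
    (Finset.univ.filter fun i => r ∈ cyclicArc l u i).card = u r.1 - l r.1 := by
  rw [← card_fin_val_mem_Ico hu]
  exact Finset.card_equiv (Equiv.subLeft r.2) fun i => by simp

/-- The game with resources `ι × Fin n` in which user `i` may use, on the circle of type `s`,
either the arc `[i, i + x s)` or the arc `[i + x s - z s, i + x s - z s + y s)`. -/
def cyclicGame (C F : ℕ → ℝ) (hC : ∀ k, 0 ≤ C k) (hC0 : C 0 = 0) (hF0 : F 0 = 0)
    (hF1 : F (n + 1) = 0) (x y z : ι → ℕ) (θ : ι → ℝ) (hθ : ∀ s, 0 ≤ θ s) : GCG n where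
  R := ι × Fin n
  finR := inferInstance
  decR := inferInstance
  act i := {cyclicArc 0 x i, cyclicArc (x - z) (x - z + y) i}
  act_ne _ := Finset.insert_nonempty _ _
  Cr r k := θ r.1 * C k
  Fr r k := θ r.1 * F k
  Cr_nonneg r k := mul_nonneg (hθ r.1) (hC k)
  Cr_zero r := by rw [hC0, mul_zero]
  Fr_zero r := by rw [hF0, mul_zero]
  Fr_top r := by rw [hF1, mul_zero]

variable {C F : ℕ → ℝ} {hC : ∀ k, 0 ≤ C k} {hC0 : C 0 = 0} {hF0 : F 0 = 0}
  {hF1 : F (n + 1) = 0} {x y z : ι → ℕ} {θ : ι → ℝ} {hθ : ∀ s, 0 ≤ θ s}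

theorem load_cyclicGame {l u : ι → ℕ} {r : ι × Fin n} (hu : u r.1 ≤ n) :
    (cyclicGame C F hC hC0 hF0 hF1 x y z θ hθ).load (cyclicArc l u) r = u r.1 - l r.1 :=
  card_users_cyclicArc hu

theorem cost_cyclicGame {l u : ι → ℕ} (hu : ∀ s, u s ≤ n) :
    (cyclicGame C F hC hC0 hF0 hF1 x y z θ hθ).cost (cyclicArc l u) =
      n * ∑ s, θ s * C (u s - l s) := by
  have h : (cyclicGame C F hC hC0 hF0 hF1 x y z θ hθ).cost (cyclicArc l u) =
      ∑ r : ι × Fin n, θ r.1 * C (u r.1 - l r.1) :=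
    Finset.sum_congr rfl fun r _ => congrArg (fun k => θ r.1 * C k) (load_cyclicGame (hu r.1))
  rw [h, Fintype.sum_prod_type, Finset.mul_sum]
  simp

theorem isNE_cyclicGame (hI : ∀ s, memI n (x s) (y s) (z s))
    (hNE : ∑ s, θ s * (((x s : ℝ) - z s) * F (x s) - ((y s : ℝ) - z s) * F (x s + 1)) ≤ 0) :
    (cyclicGame C F hC hC0 hF0 hF1 x y z θ hθ).IsNE (cyclicArc 0 x) := by
  have hx : ∀ s, x s ≤ n := fun s => (hI s).1
  have hload : ∀ r : ι × Fin n,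
      (cyclicGame C F hC hC0 hF0 hF1 x y z θ hθ).load (cyclicArc 0 x) r = x r.1 :=
    fun r => (load_cyclicGame (hx r.1)).trans (Nat.sub_zero _)
  have hu : ∀ i, (cyclicGame C F hC hC0 hF0 hF1 x y z θ hθ).ucost i (cyclicArc 0 x) =
      ∑ s, (x s : ℝ) * (θ s * F (x s)) := by
    intro i
    refine (Finset.sum_congr rfl fun r _ =>
      congrArg (fun k => θ r.1 * F k) (hload r)).trans ?_
    simpa using sum_cyclicArc (l := 0) hx i fun s => θ s * F (x s)
  refine ⟨fun i => Finset.mem_insert_self _ _, fun i b hb => ?_⟩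
  refine le_of_le_of_eq ?_ (GCG.ucost_update _ _ _ _).symm
  rcases Finset.mem_insert.1 hb with rfl | hb
  · refine (Finset.sum_congr rfl fun r hr => ?_).le
    exact (if_pos hr).symm
  rw [Finset.mem_singleton.1 hb, hu i]
  have hsplit : (∑ r ∈ cyclicArc (x - z) (x - z + y) i, if r ∈ cyclicArc 0 x i
      then θ r.1 * F (x r.1) else θ r.1 * F (x r.1 + 1)) =
      ∑ s, ((z s : ℝ) * (θ s * F (x s)) + ((y s : ℝ) - z s) * (θ s * F (x s + 1))) := by
    have h1 : (cyclicArc (x - z) (x - z + y) i).filter (· ∈ cyclicArc 0 x i) =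
        cyclicArc (x - z) x i := by
      ext r
      have := hI r.1
      unfold memI at this
      simp only [Finset.mem_filter, mem_cyclicArc, Pi.add_apply, Pi.sub_apply, Pi.zero_apply]
      omega
    have h2 : (cyclicArc (x - z) (x - z + y) i).filter (· ∉ cyclicArc 0 x i) =
        cyclicArc x (x - z + y) i := by
      ext r
      have := hI r.1
      unfold memI at this
      simp only [Finset.mem_filter, mem_cyclicArc, Pi.add_apply, Pi.sub_apply, Pi.zero_apply]
      omega
    rw [Finset.sum_ite, h1, h2, sum_cyclicArc hx i fun s => θ s * F (x s),
      sum_cyclicArc (fun s => ?_) i fun s => θ s * F (x s + 1), ← Finset.sum_add_distrib]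
    · refine Finset.sum_congr rfl fun s _ => ?_
      obtain ⟨-, -, hzx, hzy, -, -⟩ := hI s
      have e1 : x s - (x - z) s = z s := by simp only [Pi.sub_apply]; omega
      have e2 : (x - z + y) s - x s = y s - z s := by
        simp only [Pi.add_apply, Pi.sub_apply]; omega
      rw [e1, e2, Nat.cast_sub hzy]
    · obtain ⟨-, -, hzx, hzy, -, h⟩ := hI s
      simp only [Pi.add_apply, Pi.sub_apply]; omega
  have hsum : (∑ r ∈ cyclicArc (x - z) (x - z + y) i, if r ∈ cyclicArc 0 x i
      then θ r.1 * F (x r.1) else θ r.1 * F (x r.1 + 1)) =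
      ∑ r ∈ cyclicArc (x - z) (x - z + y) i, if r ∈ cyclicArc 0 x i
      then θ r.1 * F ((cyclicGame C F hC hC0 hF0 hF1 x y z θ hθ).load (cyclicArc 0 x) r)
      else θ r.1 * F ((cyclicGame C F hC hC0 hF0 hF1 x y z θ hθ).load (cyclicArc 0 x) r + 1) :=
    Finset.sum_congr rfl fun r _ => by rw [hload r]
  refine le_of_le_of_eq ?_ (hsplit.symm.trans hsum)
  rw [← sub_nonpos, ← Finset.sum_sub_distrib]
  refine le_of_eq_of_le (Finset.sum_congr rfl fun s _ => ?_) hNE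
  ring

end CyclicGame

/-- For an optimal pair `(F, ρ)` and any `ρ' > ρ`, some weighted game generated from `(C, F)` has
an equilibrium whose cost exceeds `1 / ρ'` times the cost of another allocation. -/
theorem exists_equilibrium_of_lt {n : ℕ} [NeZero n] {C F : ℕ → ℝ} {ρ ρ' : ℝ}
    (hC : ∀ k, 0 ≤ C k) (hC0 : C 0 = 0)
    (hfeas : LPfeasF n C F ρ) (hopt : ∀ F' ρ', LPfeasF n C F' ρ' → ρ' ≤ ρ) (hlt : ρ < ρ') :
    ∃ G : GCG n, (∃ w : G.R → ℝ, (∀ r, 0 ≤ w r) ∧ (∀ r k, G.Cr r k = w r * C k) ∧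
      ∀ r k, G.Fr r k = w r * F k) ∧
      ∃ a a', G.IsNE a ∧ G.Valid a' ∧ G.cost a' < ρ' * G.cost a := by
  obtain ⟨hF0, hF1, -⟩ := hfeas
  let T := {t : Fin (n + 1) × Fin (n + 1) × Fin (n + 1) //
    memIR n t.1.val t.2.1.val t.2.2.val}
  classical
  let p : T → ℝ := fun t => C t.1.2.1 - ρ' * C t.1.1
  let g : T → ℝ := fun t =>
    ((t.1.1 : ℕ) - (t.1.2.2 : ℕ) : ℝ) * F t.1.1 -
      ((t.1.2.1 : ℕ) - (t.1.2.2 : ℕ) : ℝ) * F (t.1.1 + 1)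
  obtain ⟨t, θ, hθ, hg, hp⟩ := exists_two_constraint_certificate p g (by
    intro ν hν
    by_contra! hcon
    refine hlt.not_ge (hopt (fun k => ν * F k) ρ' ⟨by simp [hF0], by simp [hF1], ?_⟩)
    intro x y z h
    have hI := h.1
    unfold memI at hI
    have := hcon ⟨(⟨x, by omega⟩, ⟨y, by omega⟩, ⟨z, by omega⟩), h⟩
    simp only [p, g] at this
    linarith)
  let x : Bool → ℕ := fun s => (t s).1.1
  let y : Bool → ℕ := fun s => (t s).1.2.1
  let z : Bool → ℕ := fun s => (t s).1.2.2
  have hI : ∀ s, memI n (x s) (y s) (z s) := fun s => (t s).2.1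
  have hu : ∀ s, (x - z + y) s ≤ n := by
    intro s
    have := hI s
    unfold memI at this
    simp only [Pi.add_apply, Pi.sub_apply]; omega
  refine ⟨cyclicGame C F hC hC0 hF0 hF1 x y z θ hθ,
    ⟨fun r => θ r.1, fun r => hθ r.1, fun _ _ => rfl, fun _ _ => rfl⟩,
    cyclicArc 0 x, cyclicArc (x - z) (x - z + y), isNE_cyclicGame hI hg,
    fun i => Finset.mem_insert_of_mem (Finset.mem_singleton_self _), ?_⟩
  rw [cost_cyclicGame hu, cost_cyclicGame fun s => (hI s).1]
  have hn : (0 : ℝ) < n := by exact_mod_cast NeZero.pos n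
  have hp' : ∑ s, θ s * C (y s) - ρ' * ∑ s, θ s * C (x s) < 0 := by
    rw [Finset.mul_sum, ← Finset.sum_sub_distrib]
    refine lt_of_eq_of_lt (Finset.sum_congr rfl fun s _ => ?_) hp
    simp only [p, x, y]
    ring
  simp only [Pi.add_apply, Pi.sub_apply, Pi.zero_apply, Nat.sub_zero, add_tsub_cancel_left]
  nlinarith

/-- The price of anarchy of the class generated from optimal pairs `(Cᶨ, Fᶨ)` is `max_j 1/ρᶨ`. -/
theorem classPoA_eq_iSup {n m : ℕ} (hn : 1 ≤ n) (hm : 0 < m)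
    (Cb : Fin m → ℕ → ℝ) (hCb : ∀ j, (∀ k, 0 ≤ Cb j k) ∧ Cb j 0 = 0)
    (Ft : Fin m → ℕ → ℝ) (ρj : Fin m → ℝ)
    (hopt : ∀ j, LPfeasF n (Cb j) (Ft j) (ρj j) ∧
      ∀ (F : ℕ → ℝ) (ρ : ℝ), LPfeasF n (Cb j) F ρ → ρ ≤ ρj j)
    (hρ : ∀ j, 0 < ρj j) :
    classPoA n Cb Ft = ⨆ j : Fin m, 1 / ρj j := by
  have : NeZero n := ⟨by omega⟩
  have : Nonempty (Fin m) := ⟨⟨0, hm⟩⟩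
  set M := ⨆ j : Fin m, 1 / ρj j
  have hMj : ∀ j, 1 / ρj j ≤ M := le_ciSup (Set.finite_range _).bddAbove
  have hM : 0 < M := (one_div_pos.2 (hρ ⟨0, hm⟩)).trans_le (hMj _)
  have hbound : ∀ G : GCG n, GeneratedFrom G Cb Ft →
      ∀ a a', G.IsNE a → G.Valid a' → G.cost a ≤ M * G.cost a' := by
    intro G hG a a' ha ha'
    have h := hG.cost_le (ρ := 1 / M) (fun j => (hCb j).1) (fun j => (hCb j).2)
      (fun j => (hopt j).1) (fun j => (one_div_le (hρ j) hM).1 (hMj j)) ha ha'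
    rwa [one_div, inv_mul_le_iff₀ hM] at h
  have hpoa : ∀ v ∈ {v | ∃ G : GCG n, GeneratedFrom G Cb Ft ∧ v = G.poa}, v ≤ M := by
    rintro _ ⟨G, hG, rfl⟩
    exact G.poa_le hM (hbound G hG)
  refine le_antisymm (Real.sSup_le hpoa hM.le) (ciSup_le fun j => ?_)
  refine le_of_forall_lt_imp_le_of_dense fun c hc => ?_
  rcases le_or_gt c 0 with hc0 | hc0
  · refine hc0.trans (Real.sSup_nonneg ?_)
    rintro _ ⟨G, -, rfl⟩
    exact G.poa_nonneg
  obtain ⟨G, ⟨w, hw, hwC, hwF⟩, a, a', ha, ha', hlt⟩ :=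
    exists_equilibrium_of_lt (hCb j).1 (hCb j).2 (hopt j).1 (hopt j).2
      ((lt_one_div hc0 (hρ j)).1 hc)
  have hG : GeneratedFrom G Cb Ft :=
    ⟨fun r j' => if j' = j then w r else 0, fun r j' => ite_nonneg (hw r) le_rfl,
      fun r k => by simp [hwC], fun r k => by simp [hwF]⟩
  have h0 := G.cost_nonneg a'
  have hpos : 0 < G.cost a := by
    by_contra! hneg
    have := mul_nonpos_of_nonneg_of_nonpos (one_div_pos.2 hc0).le hneg
    linarith
  have hpos' : 0 < G.cost a' := by
    have := hbound G hG a a' ha ha'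
    by_contra! hneg
    nlinarith
  refine le_trans ?_ ((G.le_poa hM (hbound G hG) ha ha' hpos).trans
    (le_csSup ⟨M, hpoa⟩ ⟨G, hG, rfl⟩))
  rw [le_div_iff₀ hpos']
  rw [one_div, ← div_eq_inv_mul, lt_div_iff₀ hc0] at hlt
  linarith

/-- If `(F̃ᶨ, ρᶨ)` optimally solves the incentive-design linear program for
each `j` and `ρᶨ > 0`, then the class generated from the pairs `(Cᶨ, F̃ᶨ)` has price of anarchy
`max_j 1/ρᶨ`, i.e. the worst price of anarchy among the single-pair classes `𝒢ᶨ`. -/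
theorem optimal_generating_functions_poa {n m : ℕ} (hn : 1 ≤ n) (hm : 0 < m)
    (Cb : Fin m → ℕ → ℝ) (hCb : ∀ j, (∀ k, 0 ≤ Cb j k) ∧ Cb j 0 = 0)
    (Ft : Fin m → ℕ → ℝ) (ρj : Fin m → ℝ)
    (hopt : ∀ j, LPfeasF n (Cb j) (Ft j) (ρj j) ∧
      ∀ (F : ℕ → ℝ) (ρ : ℝ), LPfeasF n (Cb j) F ρ → ρ ≤ ρj j)
    (hρ : ∀ j, 0 < ρj j) :
    classPoA n Cb Ft = ⨆ j : Fin m, 1 / ρj j ∧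
      classPoA n Cb Ft =
        ⨆ j : Fin m, classPoA n (fun _ : Fin 1 => Cb j) (fun _ : Fin 1 => Ft j) := by
  have hclass := classPoA_eq_iSup hn hm Cb hCb Ft ρj hopt hρ
  refine ⟨hclass, hclass.trans (iSup_congr fun j => ?_)⟩
  rw [classPoA_eq_iSup hn one_pos _ (fun _ => hCb j) _ (fun _ => ρj j) (fun _ => hopt j)
    (fun _ => hρ j), ciSup_const]
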